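/- For every integer M ≥ 1 and every t ∈ 𝒯_M, the spectrum of the M-fold backflow operator satisfies σ(B^{(M)}_t) ⊆ [−1 − (M−1)·c_BM, M·c_BM]; in particular sSup σ(B^{(M)}_t) ≤ M·c_BM and sInf σ(B^{(M)}_t) ≥ −1 − (M−1)·c_BM. -/

import Mathlib

open MeasureTheory Filter

noncomputable section

namespace QB

/-- Lebesgue measure on the positive half-line. -/
abbrev μp : Measure ℝ := volume.restrict (Set.Ioi (0:ℝ))

/-- The Hilbert space `L²((0,∞))`. -/
abbrev Hp : Type := Lp ℂ 2 μp

/-- The Hilbert space `L²(ℝ)`. -/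
abbrev HL : Type := Lp ℂ 2 (volume : Measure ℝ)

/-- The defining properties of the operators: `S t` is multiplication by `e^{-i k² t}`,
`R` is the isometry "extend by zero and apply the inverse Fourier–Plancherel transform"
(characterised by its isometry property together with the integral formula on
integrable elements of `L²((0,∞))`, which determine it uniquely by continuity and density),
and `Pm` is the orthogonal projection onto functions supported in `(-∞,0)`. -/
structure Setup (S : ℝ → Hp →L[ℂ] Hp) (R : Hp →L[ℂ] HL) (Pm : HL →L[ℂ] HL) : Prop where
  hS : ∀ (t : ℝ) (φ : Hp),
    (S t φ : ℝ → ℂ) =ᵐ[μp] fun k => Complex.exp (-Complex.I * (k:ℂ)^2 * (t:ℂ)) * φ k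
  hR_isometry : ∀ φ : Hp, ‖R φ‖ = ‖φ‖
  hR : ∀ φ : Hp, Integrable (φ : ℝ → ℂ) μp →
    (R φ : ℝ → ℂ) =ᵐ[volume]
      fun x => (((2 * Real.pi) ^ (-(1/2) : ℝ) : ℝ) : ℂ) *
        ∫ k in Set.Ioi (0:ℝ), Complex.exp (Complex.I * (x:ℂ) * (k:ℂ)) * φ k
  hPm : ∀ ψ : HL, (Pm ψ : ℝ → ℂ) =ᵐ[volume] Set.indicator (Set.Iio (0:ℝ)) (fun x => ψ x)

/-- The single backflow operator `B_{⟨t₁,t₂⟩} = S_{t₂}* R* Π⁻ R S_{t₂} − S_{t₁}* R* Π⁻ R S_{t₁}`. -/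
def B1 (S : ℝ → Hp →L[ℂ] Hp) (R : Hp →L[ℂ] HL) (Pm : HL →L[ℂ] HL) (t₁ t₂ : ℝ) :
    Hp →L[ℂ] Hp :=
  (ContinuousLinearMap.adjoint (S t₂)).comp ((ContinuousLinearMap.adjoint R).comp
    (Pm.comp (R.comp (S t₂))))
  - (ContinuousLinearMap.adjoint (S t₁)).comp ((ContinuousLinearMap.adjoint R).comp
    (Pm.comp (R.comp (S t₁))))

/-- The `M`-fold backflow operator `B^{(M)}_t = Σ_{j=1}^M B_{⟨t_{2j-1}, t_{2j}⟩}`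
(zero-based indexing of the tuple `t`). -/
def BM (S : ℝ → Hp →L[ℂ] Hp) (R : Hp →L[ℂ] HL) (Pm : HL →L[ℂ] HL) (M : ℕ)
    (t : Fin (2*M) → ℝ) : Hp →L[ℂ] Hp :=
  ∑ j : Fin M, B1 S R Pm (t ⟨2*j.1, by have := j.isLt; omega⟩)
    (t ⟨2*j.1+1, by have := j.isLt; omega⟩)

/-- `𝒯_M`: the set of strictly increasing `2M`-tuples of reals. -/
def TM (M : ℕ) : Set (Fin (2*M) → ℝ) := {t | StrictMono t}

/-- The Bracken–Melloy constant `c_BM = sSup σ(B_{⟨0,1⟩})`. -/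
def cBM (S : ℝ → Hp →L[ℂ] Hp) (R : Hp →L[ℂ] HL) (Pm : HL →L[ℂ] HL) : ℝ :=
  sSup (spectrum ℝ (B1 S R Pm 0 1))

section Spectrum

variable {E : Type*} [NormedAddCommGroup E] [InnerProductSpace ℂ E] [CompleteSpace E]

lemma le_algebraMap_iff_re_inner_le {a : E →L[ℂ] E} (ha : IsSelfAdjoint a) (r : ℝ) :
    a ≤ algebraMap ℝ (E →L[ℂ] E) r ↔ ∀ x, (inner ℂ (a x) x).re ≤ r * ‖x‖ ^ 2 := by
  have hsub : IsSelfAdjoint (algebraMap ℝ (E →L[ℂ] E) r - a) :=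
    (IsSelfAdjoint.algebraMap _ (IsSelfAdjoint.all r)).sub ha
  rw [ContinuousLinearMap.le_def, ContinuousLinearMap.isPositive_def',
    and_iff_right hsub]
  refine forall_congr' fun x => ?_
  have key : (algebraMap ℝ (E →L[ℂ] E) r - a).reApplyInnerSelf x
      = r * ‖x‖ ^ 2 - (inner ℂ (a x) x).re := by
    have hr : (algebraMap ℝ (E →L[ℂ] E) r) x = (r : ℂ) • x := by
      simp [Algebra.algebraMap_eq_smul_one]
    rw [ContinuousLinearMap.reApplyInnerSelf_apply, _root_.sub_apply, hr,
      inner_sub_left, inner_smul_left, inner_self_eq_norm_sq_to_K]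
    simp [← Complex.ofReal_pow]
  rw [key, sub_nonneg]

lemma re_inner_le_iff_spectrum_le {a : E →L[ℂ] E} (ha : IsSelfAdjoint a) (r : ℝ) :
    (∀ x, (inner ℂ (a x) x).re ≤ r * ‖x‖ ^ 2) ↔ ∀ z ∈ spectrum ℝ a, z ≤ r := by
  rw [← le_algebraMap_iff_re_inner_le ha]
  exact le_algebraMap_iff_spectrum_le ha

lemma le_spectrum_of_le_re_inner {a : E →L[ℂ] E} (ha : IsSelfAdjoint a) {r : ℝ}
    (h : ∀ x, r * ‖x‖ ^ 2 ≤ (inner ℂ (a x) x).re) : ∀ z ∈ spectrum ℝ a, r ≤ z := by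
  have := (re_inner_le_iff_spectrum_le ha.neg (-r)).1 fun x => by
    simpa using h x
  intro z hz
  have := this (-z) (by rw [← spectrum.neg_eq]; simpa using hz)
  linarith

lemma spectrum_real_nonempty [Nontrivial E] {a : E →L[ℂ] E} (ha : IsSelfAdjoint a) :
    (spectrum ℝ a).Nonempty :=
  ContinuousFunctionalCalculus.spectrum_nonempty a ha

end Spectrum

section Dilation

/-- `k ↦ √a · f (a k)`, the unitary dilation of `L²`. -/
def dilate (a : ℝ) (f : ℝ → ℂ) : ℝ → ℂ := fun k => ((√a : ℝ) : ℂ) * f (a * k)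

lemma map_mul_left_restrict {a : ℝ} (ha : 0 < a) {s : Set ℝ} (hs : (a * ·) ⁻¹' s = s) :
    Measure.map (a * ·) (volume.restrict s) = ENNReal.ofReal a⁻¹ • volume.restrict s := by
  have he : MeasurableEmbedding (fun x : ℝ => a * x) :=
    (Homeomorph.mulLeft₀ a ha.ne').measurableEmbedding
  have := he.restrict_map volume s
  rw [hs] at this
  rw [← this, Real.map_volume_mul_left ha.ne', abs_of_pos (inv_pos.2 ha), Measure.restrict_smul]

lemma eLpNorm_dilate {a : ℝ} (ha : 0 < a) {s : Set ℝ} (hs : (a * ·) ⁻¹' s = s) (f : ℝ → ℂ) :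
    eLpNorm (dilate a f) 2 (volume.restrict s) = eLpNorm f 2 (volume.restrict s) := by
  have he : MeasurableEmbedding (fun x : ℝ => a * x) :=
    (Homeomorph.mulLeft₀ a ha.ne').measurableEmbedding
  have h1 : dilate a f = ((√a : ℝ) : ℂ) • (f ∘ fun x => a * x) := rfl
  rw [h1, eLpNorm_const_smul, ← he.eLpNorm_map_measure, map_mul_left_restrict ha hs,
    eLpNorm_smul_measure_of_ne_top (by simp), smul_eq_mul, ← mul_assoc]
  have h2 : ‖((√a : ℝ) : ℂ)‖ₑ * ENNReal.ofReal a⁻¹ ^ (1 / (2 : ENNReal)).toReal = 1 := by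
    rw [← ofReal_norm, Complex.norm_real, Real.norm_of_nonneg (Real.sqrt_nonneg _),
      ENNReal.ofReal_rpow_of_pos (inv_pos.2 ha), ← ENNReal.ofReal_mul (Real.sqrt_nonneg _)]
    have : (1 / (2 : ENNReal)).toReal = 1 / 2 := by simp
    rw [this, ← Real.sqrt_eq_rpow, Real.sqrt_inv, mul_inv_cancel₀ (Real.sqrt_pos.2 ha).ne']
    simp
  rw [h2, one_mul]

lemma preimage_mul_left_Ioi {a : ℝ} (ha : 0 < a) :
    (a * ·) ⁻¹' Set.Ioi (0 : ℝ) = Set.Ioi 0 := by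
  ext x; simp [ha]

lemma preimage_mul_left_Iio {a : ℝ} (ha : 0 < a) :
    (a * ·) ⁻¹' Set.Iio (0 : ℝ) = Set.Iio 0 := by
  ext x; simp [ha]

lemma quasiMeasurePreserving_mul_left {a : ℝ} (ha : 0 < a) {s : Set ℝ}
    (hs : (a * ·) ⁻¹' s = s) :
    Measure.QuasiMeasurePreserving (a * ·) (volume.restrict s) (volume.restrict s) :=
  ⟨measurable_const_mul a, by
    rw [map_mul_left_restrict ha hs]; exact Measure.smul_absolutelyContinuous⟩

lemma dilate_ae_congr {a : ℝ} (ha : 0 < a) {s : Set ℝ} (hs : (a * ·) ⁻¹' s = s)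
    {f g : ℝ → ℂ} (h : f =ᵐ[volume.restrict s] g) :
    dilate a f =ᵐ[volume.restrict s] dilate a g := by
  filter_upwards [(quasiMeasurePreserving_mul_left ha hs).ae_eq_comp h] with x hx
  exact congrArg (((√a : ℝ) : ℂ) * ·) hx

lemma memLp_dilate {a : ℝ} (ha : 0 < a) (φ : Hp) : MemLp (dilate a φ) 2 μp :=
  ⟨((Lp.aestronglyMeasurable φ).comp_quasiMeasurePreserving
      (quasiMeasurePreserving_mul_left ha (preimage_mul_left_Ioi ha))).const_mul _, by
    rw [eLpNorm_dilate ha (preimage_mul_left_Ioi ha)]; exact Lp.eLpNorm_lt_top φ⟩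

/-- The dilation `φ ↦ √a · φ (a ·)` on `L²((0,∞))`. -/
def dilation {a : ℝ} (ha : 0 < a) (φ : Hp) : Hp := (memLp_dilate ha φ).toLp _

lemma coeFn_dilation {a : ℝ} (ha : 0 < a) (φ : Hp) :
    (dilation ha φ : ℝ → ℂ) =ᵐ[μp] dilate a φ := MemLp.coeFn_toLp _

lemma norm_dilation {a : ℝ} (ha : 0 < a) (φ : Hp) : ‖dilation ha φ‖ = ‖φ‖ := by
  rw [dilation, Lp.norm_toLp, eLpNorm_dilate ha (preimage_mul_left_Ioi ha), Lp.norm_def]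

lemma dilation_sub {a : ℝ} (ha : 0 < a) (φ ψ : Hp) :
    dilation ha (φ - ψ) = dilation ha φ - dilation ha ψ := by
  apply Lp.ext
  filter_upwards [coeFn_dilation ha (φ - ψ), coeFn_dilation ha φ, coeFn_dilation ha ψ,
    Lp.coeFn_sub (dilation ha φ) (dilation ha ψ),
    dilate_ae_congr ha (preimage_mul_left_Ioi ha) (Lp.coeFn_sub φ ψ)] with x h1 h2 h3 h4 h5
  rw [h1, h5, h4, Pi.sub_apply, h2, h3]
  simp [dilate, mul_sub]

lemma continuous_dilation {a : ℝ} (ha : 0 < a) : Continuous (dilation ha) :=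
  (Isometry.of_dist_eq fun φ ψ => by
    rw [dist_eq_norm, dist_eq_norm, ← dilation_sub, norm_dilation]).continuous

lemma integrable_dilation {a : ℝ} (ha : 0 < a) {φ : Hp} (h : Integrable φ μp) :
    Integrable (dilation ha φ) μp := by
  rw [integrable_congr (coeFn_dilation ha φ)]
  have : IntegrableOn (fun x => φ (a * x)) (Set.Ioi 0) :=
    (integrableOn_Ioi_comp_mul_left_iff _ _ ha).2 (by rwa [mul_zero])
  exact this.const_mul _

lemma dense_integrable : Dense {φ : Hp | Integrable φ μp} := by
  refine (Lp.simpleFunc.denseRange (E := ℂ) (μ := μp) (p := 2) (by simp)).mono ?_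
  rintro _ ⟨f, rfl⟩
  have := (SimpleFunc.memLp_iff_integrable (by simp) (by simp)).1 (Lp.simpleFunc.memLp f)
  exact this.congr (Lp.simpleFunc.toSimpleFunc_eq_toFun f)

end Dilation

namespace Setup

variable {S : ℝ → Hp →L[ℂ] Hp} {R : Hp →L[ℂ] HL} {Pm : HL →L[ℂ] HL}

lemma S_add_apply (h : Setup S R Pm) (s t : ℝ) (φ : Hp) : S (s + t) φ = S s (S t φ) := by
  apply Lp.ext
  filter_upwards [h.hS (s + t) φ, h.hS s (S t φ), h.hS t φ] with k h1 h2 h3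
  rw [h1, h2, h3, ← mul_assoc, ← Complex.exp_add]
  congr 2
  push_cast
  ring

lemma S_zero_apply (h : Setup S R Pm) (φ : Hp) : S 0 φ = φ := by
  apply Lp.ext
  filter_upwards [h.hS 0 φ] with k h1
  simp [h1]

lemma norm_S_apply (h : Setup S R Pm) (t : ℝ) (φ : Hp) : ‖S t φ‖ = ‖φ‖ := by
  rw [Lp.norm_def, Lp.norm_def]
  congr 1
  apply eLpNorm_congr_norm_ae
  filter_upwards [h.hS t φ] with k hk
  rw [hk, norm_mul]
  have : -Complex.I * (k : ℂ) ^ 2 * (t : ℂ) = ((-(k ^ 2 * t) : ℝ) : ℂ) * Complex.I := by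
    push_cast; ring
  rw [this, Complex.norm_exp_ofReal_mul_I, one_mul]

lemma S_dilation (h : Setup S R Pm) {a : ℝ} (ha : 0 < a) (t : ℝ) (φ : Hp) :
    S t (dilation ha φ) = dilation ha (S (t / a ^ 2) φ) := by
  apply Lp.ext
  filter_upwards [h.hS t (dilation ha φ), coeFn_dilation ha φ, coeFn_dilation ha (S (t / a ^ 2) φ),
    dilate_ae_congr ha (preimage_mul_left_Ioi ha) (h.hS (t / a ^ 2) φ)] with k h1 h2 h3 h4
  rw [h1, h2, h3, h4]
  have hac : (a : ℂ) ≠ 0 := by exact_mod_cast ha.ne'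
  have : -Complex.I * (k : ℂ) ^ 2 * (t : ℂ)
      = -Complex.I * ((a * k : ℝ) : ℂ) ^ 2 * ((t / a ^ 2 : ℝ) : ℂ) := by
    push_cast; field_simp
  simp only [dilate]
  rw [this]
  ring

lemma norm_Pm_apply (h : Setup S R Pm) (ψ : HL) :
    ‖Pm ψ‖ = (eLpNorm ψ 2 (volume.restrict (Set.Iio (0 : ℝ)))).toReal := by
  rw [Lp.norm_def, eLpNorm_congr_ae (h.hPm ψ)]
  exact congrArg _ (eLpNorm_indicator_eq_eLpNorm_restrict measurableSet_Iio)

lemma norm_Pm_apply_le (h : Setup S R Pm) (ψ : HL) : ‖Pm ψ‖ ≤ ‖ψ‖ := by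
  rw [h.norm_Pm_apply, Lp.norm_def]
  exact ENNReal.toReal_mono (Lp.eLpNorm_lt_top ψ).ne (eLpNorm_mono_measure _ Measure.restrict_le_self)

lemma adjoint_Pm_comp_Pm (h : Setup S R Pm) : (ContinuousLinearMap.adjoint Pm).comp Pm = Pm := by
  ext1 ψ
  refine ext_inner_left ℂ fun η => ?_
  rw [ContinuousLinearMap.comp_apply, ContinuousLinearMap.adjoint_inner_right, L2.inner_def,
    L2.inner_def]
  apply integral_congr_ae
  filter_upwards [h.hPm ψ, h.hPm η] with x h1 h2
  rw [h1, h2]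
  by_cases hx : x ∈ Set.Iio (0 : ℝ) <;> simp [hx]

lemma R_dilation (h : Setup S R Pm) {a : ℝ} (ha : 0 < a) {φ : Hp} (hφ : Integrable φ μp) :
    (R (dilation ha φ) : ℝ → ℂ) =ᵐ[volume] dilate a⁻¹ (R φ) := by
  have hR := dilate_ae_congr (inv_pos.2 ha) (s := Set.univ) (by simp)
    (ae_restrict_of_ae (h.hR φ hφ))
  rw [Measure.restrict_univ] at hR
  refine (h.hR _ (integrable_dilation ha hφ)).trans (EventuallyEq.trans ?_ hR.symm)
  refine Eventually.of_forall fun x => ?_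
  have h1 : ∫ k in Set.Ioi (0 : ℝ), Complex.exp (Complex.I * (x : ℂ) * (k : ℂ)) * dilation ha φ k
      = ∫ k in Set.Ioi (0 : ℝ), ((√a : ℝ) : ℂ) *
        (Complex.exp (Complex.I * ((a⁻¹ * x : ℝ) : ℂ) * ((a * k : ℝ) : ℂ)) * φ (a * k)) := by
    apply integral_congr_ae
    filter_upwards [coeFn_dilation ha φ] with k hk
    have hac : (a : ℂ) ≠ 0 := by exact_mod_cast ha.ne'
    have : Complex.I * (x : ℂ) * (k : ℂ)
        = Complex.I * ((a⁻¹ * x : ℝ) : ℂ) * ((a * k : ℝ) : ℂ) := by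
      push_cast; field_simp
    rw [hk, this, dilate]
    ring
  have h2 := integral_comp_mul_left_Ioi
    (fun u : ℝ => Complex.exp (Complex.I * ((a⁻¹ * x : ℝ) : ℂ) * (u : ℂ)) * φ u) 0 ha
  rw [mul_zero] at h2
  have h3 : ((√a : ℝ) : ℂ) * ((a⁻¹ : ℝ) : ℂ) = ((√a⁻¹ : ℝ) : ℂ) := by
    rw [← Complex.ofReal_mul, Real.sqrt_inv]
    congr 1
    have := Real.sqrt_pos.2 ha
    field_simp
    exact (Real.sq_sqrt ha.le)
  simp only [dilate]
  rw [h1, integral_const_mul, h2, Complex.real_smul, ← h3]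
  ring

lemma norm_Pm_R_dilation (h : Setup S R Pm) {a : ℝ} (ha : 0 < a) (φ : Hp) :
    ‖Pm (R (dilation ha φ))‖ = ‖Pm (R φ)‖ := by
  have hc := continuous_dilation ha
  refine congrFun (Continuous.ext_on dense_integrable (by fun_prop) (by fun_prop)
    (fun φ hφ => ?_) : (fun φ : Hp => ‖Pm (R (dilation ha φ))‖) = fun φ => ‖Pm (R φ)‖) φ
  rw [h.norm_Pm_apply, h.norm_Pm_apply, eLpNorm_congr_ae (ae_restrict_of_ae (h.R_dilation ha hφ)),
    eLpNorm_dilate (inv_pos.2 ha) (preimage_mul_left_Iio (inv_pos.2 ha))]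

lemma B1_eq (h : Setup S R Pm) (s t : ℝ) :
    B1 S R Pm s t =
      (ContinuousLinearMap.adjoint (Pm.comp (R.comp (S t)))).comp (Pm.comp (R.comp (S t))) -
      (ContinuousLinearMap.adjoint (Pm.comp (R.comp (S s)))).comp (Pm.comp (R.comp (S s))) := by
  have key (t : ℝ) : (ContinuousLinearMap.adjoint (Pm.comp (R.comp (S t)))).comp
      (Pm.comp (R.comp (S t))) = (ContinuousLinearMap.adjoint (S t)).comp
        ((ContinuousLinearMap.adjoint R).comp (Pm.comp (R.comp (S t)))) := by
    conv_rhs => rw [← h.adjoint_Pm_comp_Pm]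
    simp only [ContinuousLinearMap.adjoint_comp, ContinuousLinearMap.comp_assoc]
  rw [key, key, B1]

lemma isSelfAdjoint_B1 (h : Setup S R Pm) (s t : ℝ) : IsSelfAdjoint (B1 S R Pm s t) := by
  rw [h.B1_eq]
  exact (ContinuousLinearMap.isPositive_adjoint_comp_self _).isSelfAdjoint.sub
    (ContinuousLinearMap.isPositive_adjoint_comp_self _).isSelfAdjoint

lemma re_inner_B1 (h : Setup S R Pm) (s t : ℝ) (φ : Hp) :
    (inner ℂ (B1 S R Pm s t φ) φ).re = ‖Pm (R (S t φ))‖ ^ 2 - ‖Pm (R (S s φ))‖ ^ 2 := by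
  rw [h.B1_eq, _root_.sub_apply, inner_sub_left,
    ContinuousLinearMap.comp_apply (ContinuousLinearMap.adjoint _),
    ContinuousLinearMap.comp_apply (ContinuousLinearMap.adjoint _),
    ContinuousLinearMap.adjoint_inner_left, ContinuousLinearMap.adjoint_inner_left,
    inner_self_eq_norm_sq_to_K, inner_self_eq_norm_sq_to_K]
  simp [← Complex.ofReal_pow]

lemma re_inner_B1_le_cBM (h : Setup S R Pm) {s t : ℝ} (hst : s < t) (φ : Hp) :
    (inner ℂ (B1 S R Pm s t φ) φ).re ≤ cBM S R Pm * ‖φ‖ ^ 2 := by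
  have hb : BddAbove (spectrum ℝ (B1 S R Pm 0 1)) := (spectrum.isCompact _).bddAbove
  have hc := (re_inner_le_iff_spectrum_le (h.isSelfAdjoint_B1 0 1) (cBM S R Pm)).2
    fun z hz => le_csSup hb hz
  have hpos : 0 < t - s := sub_pos.2 hst
  have ha : 0 < (√(t - s))⁻¹ := inv_pos.2 (Real.sqrt_pos.2 hpos)
  have h0 : ‖Pm (R (S 0 (dilation ha (S s φ))))‖ = ‖Pm (R (S s φ))‖ := by
    rw [h.S_zero_apply, h.norm_Pm_R_dilation]
  have h1 : ‖Pm (R (S 1 (dilation ha (S s φ))))‖ = ‖Pm (R (S t φ))‖ := by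
    rw [h.S_dilation, h.norm_Pm_R_dilation, inv_pow, Real.sq_sqrt hpos.le, ← h.S_add_apply]
    congr 4
    simp
  have := hc (dilation ha (S s φ))
  rwa [h.re_inner_B1, h0, h1, ← h.re_inner_B1, norm_dilation, h.norm_S_apply] at this

end Setup

lemma nontrivial_Hp : Nontrivial Hp := by
  have hμ : μp (Set.Ioc 0 1) = 1 := by
    rw [Measure.restrict_apply measurableSet_Ioc,
      Set.inter_eq_left.2 Set.Ioc_subset_Ioi_self]
    simp
  have hμ' : μp (Set.Ioc 0 1) ≠ ⊤ := by simp [hμ]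
  refine ⟨⟨indicatorConstLp 2 measurableSet_Ioc hμ' (1 : ℂ), 0, fun h => ?_⟩⟩
  have h1 := norm_indicatorConstLp (p := 2) (hs := measurableSet_Ioc) (hμs := hμ') (c := (1 : ℂ))
    (by simp) (by simp)
  rw [h] at h1
  simp [Measure.real, hμ] at h1

/-- Telescoping: a sum of alternate increments of `q` is bounded below by the total increment
minus a bound for each of the omitted increments. -/
lemma sum_alternate_increments_ge (q : ℕ → ℝ) (c : ℝ) (n : ℕ)
    (hq : ∀ j < n, q (2 * j + 2) - q (2 * j + 1) ≤ c) :
    q (2 * n + 1) - q 0 - n * c ≤ ∑ j ∈ Finset.range (n + 1), (q (2 * j + 1) - q (2 * j)) := by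
  induction n with
  | zero => simp
  | succ n ih =>
    have h1 := ih fun j hj => hq j (by omega)
    have h2 := hq n (by omega)
    rw [Finset.sum_range_succ]
    push_cast
    rw [show 2 * (n + 1) = 2 * n + 2 by ring]
    linarith

/-- `σ(B^{(M)}_t) ⊆ [−1 − (M−1)c_BM, M·c_BM]`; in particular the supremum and
infimum of the spectrum obey the corresponding bounds. -/
theorem backflow_spectrum_outer_bounds
    (S : ℝ → Hp →L[ℂ] Hp) (R : Hp →L[ℂ] HL) (Pm : HL →L[ℂ] HL)
    (hSetup : Setup S R Pm) (M : ℕ) (hM : 1 ≤ M)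
    (t : Fin (2*M) → ℝ) (ht : t ∈ TM M) :
    spectrum ℝ (BM S R Pm M t)
      ⊆ Set.Icc (-1 - ((M:ℝ) - 1) * cBM S R Pm) ((M:ℝ) * cBM S R Pm) ∧
    sSup (spectrum ℝ (BM S R Pm M t)) ≤ (M:ℝ) * cBM S R Pm ∧
    -1 - ((M:ℝ) - 1) * cBM S R Pm ≤ sInf (spectrum ℝ (BM S R Pm M t)) := by
  have hnt : Nontrivial Hp := nontrivial_Hp
  have hsa : IsSelfAdjoint (BM S R Pm M t) :=
    isSelfAdjoint_sum _ fun j _ => hSetup.isSelfAdjoint_B1 _ _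
  have hinner (φ : Hp) : (inner ℂ (BM S R Pm M t φ) φ).re = ∑ j : Fin M,
      (inner ℂ (B1 S R Pm (t ⟨2 * j.1, by have := j.isLt; omega⟩)
        (t ⟨2 * j.1 + 1, by have := j.isLt; omega⟩) φ) φ).re := by
    rw [BM, _root_.sum_apply, sum_inner, Complex.re_sum]
  have hupper : ∀ z ∈ spectrum ℝ (BM S R Pm M t), z ≤ (M : ℝ) * cBM S R Pm := by
    refine (re_inner_le_iff_spectrum_le hsa _).1 fun φ => ?_
    rw [hinner]
    refine (Finset.sum_le_sum fun j _ => hSetup.re_inner_B1_le_cBM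
      (ht (Fin.mk_lt_mk.2 (Nat.lt_succ_self _))) φ).trans_eq ?_
    simp [mul_assoc]
  have hlower : ∀ z ∈ spectrum ℝ (BM S R Pm M t), -1 - ((M : ℝ) - 1) * cBM S R Pm ≤ z := by
    refine le_spectrum_of_le_re_inner hsa fun φ => ?_
    obtain ⟨n, rfl⟩ : ∃ n, M = n + 1 := ⟨M - 1, by omega⟩
    let q : ℕ → ℝ := fun i => if hi : i < 2 * (n + 1) then ‖Pm (R (S (t ⟨i, hi⟩) φ))‖ ^ 2 else 0
    have hq0 : q 0 ≤ ‖φ‖ ^ 2 := by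
      simp only [q]
      rw [dif_pos (by omega)]
      gcongr
      exact (hSetup.norm_Pm_apply_le _).trans_eq
        ((hSetup.hR_isometry _).trans (hSetup.norm_S_apply _ _))
    have hqn : 0 ≤ q (2 * n + 1) := by
      simp only [q]
      split_ifs <;> positivity
    have hgap : ∀ j < n, q (2 * j + 2) - q (2 * j + 1) ≤ cBM S R Pm * ‖φ‖ ^ 2 := fun j hj => by
      simp only [q]
      rw [dif_pos (by omega), dif_pos (by omega), ← hSetup.re_inner_B1]
      exact hSetup.re_inner_B1_le_cBM (ht (Fin.mk_lt_mk.2 (Nat.lt_succ_self _))) φ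
    have hsum := sum_alternate_increments_ge q _ n hgap
    have heq : (inner ℂ (BM S R Pm (n + 1) t φ) φ).re
        = ∑ j ∈ Finset.range (n + 1), (q (2 * j + 1) - q (2 * j)) := by
      rw [hinner, Finset.sum_range]
      refine Finset.sum_congr rfl fun j _ => ?_
      have := j.isLt
      simp only [q]
      rw [dif_pos (by omega), dif_pos (by omega), ← hSetup.re_inner_B1]
    rw [heq]
    push_cast
    linarith
  have hne := spectrum_real_nonempty hsa
  exact ⟨fun z hz => ⟨hlower z hz, hupper z hz⟩, csSup_le hne hupper, le_csInf hne hlower⟩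

end QB
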